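/- arXiv:1507.02324 — 2 statements merged into one kernel-verified Lean document; each statement's English description precedes it below -/
import Mathlib

section
/- For every left ideal Y₁ of W₂ there exists a left ideal Y₂ of W₂ such that W₂ = Y₁ + Y₂ and Y₁ ∩ Y₂ = 0. -/
noncomputable section

variable (F : Type*) [Field F] [CharZero F]

abbrev V2 (F : Type*) [Field F] : Type _ := Fin 2 → F

abbrev WW (F : Type*) [Field F] : Type _ := V2 F →ₗ[F] V2 F →ₗ[F] V2 F

def vone : V2 F := ![1, 0]

/-- The multiplication on the space of bilinear maps. -/
def wmul (A B : WW F) : WW F :=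
  LinearMap.mk₂ F
    (fun x y => A (vone F) (B x y) - B (A (vone F) x) y - B x (A (vone F) y))
    (fun x x' y => by simp only [map_add, LinearMap.add_apply]; abel)
    (fun c x y => by simp only [map_smul, LinearMap.smul_apply, smul_sub])
    (fun x y y' => by simp only [map_add, LinearMap.add_apply]; abel)
    (fun c x y => by simp only [map_smul, LinearMap.smul_apply, smul_sub])

/-- α_{ij}^k -/
def alphaM (i j k : Fin 2) : WW F :=
  LinearMap.mk₂ F (fun x y => (x i * y j) • (Pi.single k (1 : F) : V2 F))
    (fun x x' y => by simp [add_mul, add_smul])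
    (fun c x y => by simp [smul_smul, mul_assoc])
    (fun x y y' => by simp [mul_add, add_smul])
    (fun c x y => by simp [smul_smul, mul_assoc, mul_left_comm])

/-- The basis e₁, …, e₈ of W(2) (indexed 0,…,7). -/
def bE : Fin 8 → WW F :=
  ![alphaM F 0 0 0 - alphaM F 0 1 1 - alphaM F 1 0 1,
    alphaM F 0 0 1,
    alphaM F 1 1 1 - alphaM F 0 1 0 - alphaM F 1 0 0,
    alphaM F 1 1 0,
    (2 : F) • alphaM F 0 0 0 + alphaM F 0 1 1 + alphaM F 1 0 1,
    (2 : F) • alphaM F 1 1 1 + alphaM F 0 1 0 + alphaM F 1 0 0,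
    alphaM F 0 1 0 - alphaM F 1 0 0,
    alphaM F 0 1 1 - alphaM F 1 0 1]


/-- W₂ = span{e₁, …, e₆}, the algebra of commutative multiplications on V₂. -/
def W2span : Submodule F (WW F) :=
  Submodule.span F {bE F 0, bE F 1, bE F 2, bE F 3, bE F 4, bE F 5}

/-- The element of `W₂` with coordinates `a, …, f` in the basis `e₁, …, e₆`. -/
def combE (F : Type*) [Field F] (a b c d e f : F) : WW F :=
  a • bE F 0 + b • bE F 1 + c • bE F 2 + d • bE F 3 + e • bE F 4 + f • bE F 5

/-- The four-dimensional simple left ideal spanned by `e₁, …, e₄`. -/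
def idealP (F : Type*) [Field F] : Submodule F (WW F) :=
  Submodule.span F {bE F 0, bE F 1, bE F 2, bE F 3}

/-- The two-dimensional simple left ideal spanned by `e₅, e₆`. -/
def idealQ (F : Type*) [Field F] : Submodule F (WW F) := Submodule.span F {bE F 4, bE F 5}

lemma combE_add {F : Type*} [Field F] (a b c d e f a' b' c' d' e' f' : F) :
    combE F a b c d e f + combE F a' b' c' d' e' f' =
      combE F (a + a') (b + b') (c + c') (d + d') (e + e') (f + f') := by
  unfold combE; module

lemma smul_combE {F : Type*} [Field F] (r a b c d e f : F) :
    r • combE F a b c d e f = combE F (r * a) (r * b) (r * c) (r * d) (r * e) (r * f) := by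
  unfold combE; module

lemma combE_zero {F : Type*} [Field F] : combE F 0 0 0 0 0 0 = 0 := by
  simp [combE]

lemma mem_W2span_iff {F : Type*} [Field F] {y : WW F} :
    y ∈ W2span F ↔ ∃ a b c d e f, combE F a b c d e f = y := by
  simp only [W2span, Submodule.mem_span_insert, Submodule.mem_span_singleton, combE]
  constructor
  · rintro ⟨a, _, ⟨b, _, ⟨c, _, ⟨d, _, ⟨e, _, ⟨f, rfl⟩, rfl⟩, rfl⟩, rfl⟩, rfl⟩, rfl⟩
    exact ⟨a, b, c, d, e, f, by abel⟩
  · rintro ⟨a, b, c, d, e, f, rfl⟩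
    exact ⟨a, _, ⟨b, _, ⟨c, _, ⟨d, _, ⟨e, _, ⟨f, rfl⟩, rfl⟩, rfl⟩, rfl⟩, rfl⟩, by abel⟩

lemma mem_idealP_iff {F : Type*} [Field F] {y : WW F} :
    y ∈ idealP F ↔ ∃ a b c d, combE F a b c d 0 0 = y := by
  simp only [idealP, Submodule.mem_span_insert, Submodule.mem_span_singleton, combE]
  constructor
  · rintro ⟨a, _, ⟨b, _, ⟨c, _, ⟨d, rfl⟩, rfl⟩, rfl⟩, rfl⟩
    exact ⟨a, b, c, d, by module⟩
  · rintro ⟨a, b, c, d, rfl⟩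
    exact ⟨a, _, ⟨b, _, ⟨c, _, ⟨d, rfl⟩, rfl⟩, rfl⟩, by module⟩

lemma mem_idealQ_iff {F : Type*} [Field F] {y : WW F} :
    y ∈ idealQ F ↔ ∃ e f, combE F 0 0 0 0 e f = y := by
  simp only [idealQ, Submodule.mem_span_insert, Submodule.mem_span_singleton, combE]
  constructor
  · rintro ⟨e, _, ⟨f, rfl⟩, rfl⟩
    exact ⟨e, f, by module⟩
  · rintro ⟨e, f, rfl⟩
    exact ⟨e, _, ⟨f, rfl⟩, by module⟩

lemma combE_apply {F : Type*} [Field F] (a b c d e f : F) (x y : V2 F) :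
    combE F a b c d e f x y =
      ![(a + 2 * e) * (x 0 * y 0) + (f - c) * (x 0 * y 1 + x 1 * y 0) + d * (x 1 * y 1),
        b * (x 0 * y 0) + (e - a) * (x 0 * y 1 + x 1 * y 0) + (c + 2 * f) * (x 1 * y 1)] := by
  ext k
  fin_cases k <;> simp [combE, bE, alphaM] <;> ring

lemma wmul_apply {F : Type*} [Field F] (A B : WW F) (x y : V2 F) :
    wmul F A B x y = A (vone F) (B x y) - B (A (vone F) x) y - B x (A (vone F) y) := rfl

/-- The multiplication of `W₂` in coordinates. -/
lemma wmul_combE {F : Type*} [Field F] [CharZero F] (a b c d e f a' b' c' d' e' f' : F) :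
    wmul F (combE F a b c d e f) (combE F a' b' c' d' e' f') =
      combE F
        (-(a + e / 2) * a' + b * (2 * c') + (f - c) * b' - 3 / 2 * e * a')
        (-3 * (a + e / 2) * b' + b * (3 * a') - 3 / 2 * e * b')
        ((a + e / 2) * c' + b * d' + (f - c) * (2 * a') - 3 / 2 * e * c')
        (3 * (a + e / 2) * d' + (f - c) * (3 * c') - 3 / 2 * e * d')
        (-(a + e / 2) * e' - b * f' - 3 / 2 * e * e')
        ((a + e / 2) * f' - (f - c) * e' - 3 / 2 * e * f') := by
  refine LinearMap.ext₂ fun x y => ?_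
  simp only [wmul_apply, combE_apply, vone]
  ext k
  fin_cases k <;> simp <;> ring

/-- Coordinates with respect to `e₁, …, e₄` and `e₅, e₆` are independent. -/
lemma idealP_inf_idealQ (F : Type*) [Field F] [CharZero F] : idealP F ⊓ idealQ F = ⊥ := by
  rw [eq_bot_iff]
  rintro y ⟨hP, hQ⟩
  obtain ⟨a, b, c, d, rfl⟩ := mem_idealP_iff.1 hP
  obtain ⟨e, f, h⟩ := mem_idealQ_iff.1 hQ
  have ev (i j k : Fin 2) := congrFun (LinearMap.congr_fun₂ h (Pi.single i 1) (Pi.single j 1)) k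
  have h1 := ev 0 0 0
  have h2 := ev 0 1 1
  have h3 := ev 1 1 1
  have h4 := ev 0 1 0
  simp [combE_apply] at h1 h2 h3 h4
  have he : e = 0 := by linear_combination (h1 + h2) / 3
  have hf : f = 0 := by linear_combination (h3 + h4) / 3
  subst he hf
  rw [Submodule.mem_bot, ← h, combE_zero]

lemma idealP_sup_idealQ (F : Type*) [Field F] : idealP F ⊔ idealQ F = W2span F := by
  rw [idealP, idealQ, W2span, ← Submodule.span_union]
  congr 1
  ext; simp; tauto

lemma wmul_mem_idealP {F : Type*} [Field F] [CharZero F] :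
    ∀ x ∈ W2span F, ∀ y ∈ idealP F, wmul F x y ∈ idealP F := by
  intro x hx y hy
  obtain ⟨a, b, c, d, e, f, rfl⟩ := mem_W2span_iff.1 hx
  obtain ⟨a', b', c', d', rfl⟩ := mem_idealP_iff.1 hy
  exact mem_idealP_iff.2 ⟨_, _, _, _, by rw [wmul_combE]; congr 1 <;> ring⟩

lemma wmul_mem_idealQ {F : Type*} [Field F] [CharZero F] :
    ∀ x ∈ W2span F, ∀ y ∈ idealQ F, wmul F x y ∈ idealQ F := by
  intro x hx y hy
  obtain ⟨a, b, c, d, e, f, rfl⟩ := mem_W2span_iff.1 hx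
  obtain ⟨e', f', rfl⟩ := mem_idealQ_iff.1 hy
  exact mem_idealQ_iff.2 ⟨_, _, by rw [wmul_combE]; congr 1 <;> ring⟩

section LeftIdeal

variable {F : Type*} [Field F] [CharZero F] {Y : Submodule F (WW F)}
  (hY : ∀ x ∈ W2span F, ∀ y ∈ Y, wmul F x y ∈ Y)
include hY

/-- Left multiplication by `-e₃` is the raising operator. -/
lemma raise_mem {a b c d e f : F} (h : combE F a b c d e f ∈ Y) :
    combE F b 0 (2 * a) (3 * c) 0 (-e) ∈ Y := by
  have := hY _ (mem_W2span_iff.2 ⟨0, 0, -1, 0, 0, 0, rfl⟩) _ h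
  rw [wmul_combE] at this
  convert this using 1
  congr 1 <;> ring

/-- Left multiplication by `e₂` is the lowering operator. -/
lemma lower_mem {a b c d e f : F} (h : combE F a b c d e f ∈ Y) :
    combE F (2 * c) (3 * a) d 0 (-f) 0 ∈ Y := by
  have := hY _ (mem_W2span_iff.2 ⟨0, 1, 0, 0, 0, 0, rfl⟩) _ h
  rw [wmul_combE] at this
  convert this using 1
  congr 1 <;> ring

/-- Left multiplication by `e₁` is the weight operator. -/
lemma weight_mem {a b c d e f : F} (h : combE F a b c d e f ∈ Y) :
    combE F (-a) (-3 * b) c (3 * d) (-e) f ∈ Y := by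
  have := hY _ (mem_W2span_iff.2 ⟨1, 0, 0, 0, 0, 0, rfl⟩) _ h
  rw [wmul_combE] at this
  convert this using 1
  congr 1 <;> ring

/-- The projection to the span of `e₁, …, e₄` is a polynomial in the Casimir operator. -/
lemma projP_mem {a b c d e f : F} (h : combE F a b c d e f ∈ Y) :
    combE F a b c d 0 0 ∈ Y := by
  have h1 := lower_mem hY (raise_mem hY h)
  have h2 := weight_mem hY h
  have h3 := weight_mem hY h2
  have := Y.add_mem (Y.add_mem (Y.smul_mem (1 / 3) h1) (Y.smul_mem (1 / 6) h2))
    (Y.add_mem (Y.smul_mem (1 / 12) h3) (Y.smul_mem (-1 / 4) h))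
  simp only [smul_combE, combE_add] at this
  convert this using 1
  congr 1 <;> ring

lemma projQ_mem {a b c d e f : F} (h : combE F a b c d e f ∈ Y) :
    combE F 0 0 0 0 e f ∈ Y := by
  have := Y.add_mem h (Y.smul_mem (-1) (projP_mem hY h))
  simp only [smul_combE, combE_add] at this
  convert this using 1
  congr 1 <;> ring

lemma idealP_le_of_lowest_mem {r : F} (hr : r ≠ 0) (h : combE F 0 r 0 0 0 0 ∈ Y) :
    idealP F ≤ Y := by
  intro y hy
  obtain ⟨a, b, c, d, rfl⟩ := mem_idealP_iff.1 hy
  have h1 := raise_mem hY h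
  have h2 := raise_mem hY h1
  have h3 := raise_mem hY h2
  have := Y.add_mem (Y.add_mem (Y.smul_mem (b / r) h) (Y.smul_mem (a / r) h1))
    (Y.add_mem (Y.smul_mem (c / (2 * r)) h2) (Y.smul_mem (d / (6 * r)) h3))
  simp only [smul_combE, combE_add] at this
  convert this using 1
  congr 1 <;> field_simp <;> ring

lemma idealP_le_of_mem {a b c d : F} (h : combE F a b c d 0 0 ∈ Y)
    (hne : combE F a b c d 0 0 ≠ 0) : idealP F ≤ Y := by
  have h1 := lower_mem hY h
  have h2 := lower_mem hY h1
  have h3 := lower_mem hY h2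
  by_cases hd : d = 0
  · subst hd
    by_cases hc : c = 0
    · subst hc
      by_cases ha : a = 0
      · subst ha
        refine idealP_le_of_lowest_mem hY (r := b) ?_ h
        rintro rfl
        exact hne combE_zero
      · exact idealP_le_of_lowest_mem hY (r := 3 * a) (by simp [ha]) (by simpa using h1)
    · exact idealP_le_of_lowest_mem hY (r := 3 * (2 * c)) (by simp [hc]) (by simpa using h2)
  · exact idealP_le_of_lowest_mem hY (r := 3 * (2 * d)) (by simp [hd]) (by simpa using h3)

lemma idealQ_le_of_lowest_mem {r : F} (hr : r ≠ 0) (h : combE F 0 0 0 0 r 0 ∈ Y) :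
    idealQ F ≤ Y := by
  intro y hy
  obtain ⟨e, f, rfl⟩ := mem_idealQ_iff.1 hy
  have := Y.add_mem (Y.smul_mem (e / r) h) (Y.smul_mem (-f / r) (raise_mem hY h))
  simp only [smul_combE, combE_add] at this
  convert this using 1
  congr 1 <;> field_simp <;> ring

lemma idealQ_le_of_mem {e f : F} (h : combE F 0 0 0 0 e f ∈ Y)
    (hne : combE F 0 0 0 0 e f ≠ 0) : idealQ F ≤ Y := by
  by_cases hf : f = 0
  · subst hf
    refine idealQ_le_of_lowest_mem hY (r := e) ?_ h
    rintro rfl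
    exact hne combE_zero
  · exact idealQ_le_of_lowest_mem hY (r := -f) (by simp [hf]) (by simpa using lower_mem hY h)

lemma le_idealQ_of_not_idealP_le (hle : Y ≤ W2span F) (hP : ¬ idealP F ≤ Y) : Y ≤ idealQ F := by
  intro y hy
  obtain ⟨a, b, c, d, e, f, rfl⟩ := mem_W2span_iff.1 (hle hy)
  have h0 : combE F a b c d 0 0 = 0 := by
    by_contra hne
    exact hP (idealP_le_of_mem hY (projP_mem hY hy) hne)
  refine mem_idealQ_iff.2 ⟨e, f, ?_⟩
  rw [← zero_add (combE F 0 0 0 0 e f), ← h0, combE_add]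
  simp

lemma le_idealP_of_not_idealQ_le (hle : Y ≤ W2span F) (hQ : ¬ idealQ F ≤ Y) : Y ≤ idealP F := by
  intro y hy
  obtain ⟨a, b, c, d, e, f, rfl⟩ := mem_W2span_iff.1 (hle hy)
  have h0 : combE F 0 0 0 0 e f = 0 := by
    by_contra hne
    exact hQ (idealQ_le_of_mem hY (projQ_mem hY hy) hne)
  refine mem_idealP_iff.2 ⟨a, b, c, d, ?_⟩
  rw [← add_zero (combE F a b c d 0 0), ← h0, combE_add]
  simp

end LeftIdeal

/-- Every left ideal of W₂ has a complementary left ideal in W₂. -/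
theorem statement8 (Y1 : Submodule F (WW F)) (hle : Y1 ≤ W2span F)
    (hY1 : ∀ x ∈ W2span F, ∀ y ∈ Y1, wmul F x y ∈ Y1) :
    ∃ Y2 : Submodule F (WW F), Y2 ≤ W2span F ∧
      (∀ x ∈ W2span F, ∀ y ∈ Y2, wmul F x y ∈ Y2) ∧
      Y1 ⊔ Y2 = W2span F ∧ Y1 ⊓ Y2 = ⊥ := by
  have hsup := idealP_sup_idealQ F
  have hinf := idealP_inf_idealQ F
  by_cases hP : idealP F ≤ Y1
  · by_cases hQ : idealQ F ≤ Y1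
    · refine ⟨⊥, bot_le, ?_, ?_, inf_bot_eq _⟩
      · rintro x - y hy
        rw [Submodule.mem_bot] at hy ⊢
        subst hy
        ext
        simp [wmul]
      · rw [sup_bot_eq]
        exact le_antisymm hle (hsup ▸ sup_le hP hQ)
    · obtain rfl := le_antisymm hP (le_idealP_of_not_idealQ_le hY1 hle hQ)
      exact ⟨idealQ F, hsup ▸ le_sup_right, wmul_mem_idealQ, hsup, hinf⟩
  · have hYQ := le_idealQ_of_not_idealP_le hY1 hle hP
    by_cases hQ : idealQ F ≤ Y1
    · obtain rfl := le_antisymm hQ hYQ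
      exact ⟨idealP F, hsup ▸ le_sup_left, wmul_mem_idealP, by rw [sup_comm, hsup],
        by rw [inf_comm, hinf]⟩
    · have hbot : Y1 = ⊥ :=
        eq_bot_iff.2 (hinf ▸ le_inf (le_idealP_of_not_idealQ_le hY1 hle hQ) hYQ)
      refine ⟨W2span F, le_rfl, ?_, by rw [hbot, bot_sup_eq], by rw [hbot, bot_inf_eq]⟩
      intro x hx y hy
      obtain ⟨a, b, c, d, e, f, rfl⟩ := mem_W2span_iff.1 hx
      obtain ⟨a', b', c', d', e', f', rfl⟩ := mem_W2span_iff.1 hy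
      exact mem_W2span_iff.2 ⟨_, _, _, _, _, _, (wmul_combE ..).symm⟩

end
end

section
/- For every f ∈ GL(V₂,v₁), the automorphism Φ(f) of W(2) given by (Φ(f)(A))(x,y) = f(A(f⁻¹(x), f⁻¹(y))) maps the subalgebra S₂ onto itself, and the induced group homomorphism GL(V₂,v₁) → Aut(S₂) is bijective: every algebra automorphism of S₂ is the restriction of Φ(f) for exactly one f ∈ GL(V₂) with f(v₁) = v₁. -/
noncomputable section

variable (F : Type*) [Field F] [CharZero F]

/-- Φ(f) : W(2) → W(2), A ↦ ((x,y) ↦ f(A(f⁻¹x, f⁻¹y))). -/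
def PsiMap (f : V2 F ≃ₗ[F] V2 F) : WW F ≃ₗ[F] WW F :=
  LinearEquiv.arrowCongr f (LinearEquiv.arrowCongr f f)

/-- S₂ = span{e₁, e₂, e₃, e₄}. -/
def S2span : Submodule F (WW F) :=
  Submodule.span F {bE F 0, bE F 1, bE F 2, bE F 3}

/-- The element `a e₁ + b e₂ + c e₃ + d e₄` of `S₂`. -/
def ofCoords (a b c d : F) : WW F :=
  a • bE F 0 + b • bE F 1 + c • bE F 2 + d • bE F 3

theorem ofCoords_apply (a b c d : F) (x y : V2 F) :
    ofCoords F a b c d x y =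
      ![a * (x 0 * y 0) - c * (x 0 * y 1 + x 1 * y 0) + d * (x 1 * y 1),
        b * (x 0 * y 0) - a * (x 0 * y 1 + x 1 * y 0) + c * (x 1 * y 1)] := by
  ext i
  fin_cases i <;> simp [ofCoords, bE, alphaM] <;> ring

theorem mem_S2span_iff (A : WW F) :
    A ∈ S2span F ↔ ∃ a b c d : F, A = ofCoords F a b c d := by
  simp only [S2span, Submodule.mem_span_insert, Submodule.mem_span_singleton, ofCoords]
  constructor
  · rintro ⟨a, _, ⟨b, _, ⟨c, _, ⟨d, rfl⟩, rfl⟩, rfl⟩, rfl⟩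
    exact ⟨a, b, c, d, by abel⟩
  · rintro ⟨a, b, c, d, rfl⟩
    exact ⟨a, _, ⟨b, _, ⟨c, _, ⟨d, rfl⟩, rfl⟩, rfl⟩, by abel⟩

theorem ofCoords_mem (a b c d : F) : ofCoords F a b c d ∈ S2span F :=
  (mem_S2span_iff F _).2 ⟨a, b, c, d, rfl⟩

theorem ofCoords_inj {a b c d a' b' c' d' : F} :
    ofCoords F a b c d = ofCoords F a' b' c' d' ↔ a = a' ∧ b = b' ∧ c = c' ∧ d = d' := by
  constructor
  · intro h
    have h₁ := congrArg (fun A : WW F => A ![1, 0] ![1, 0]) h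
    have h₂ := congrArg (fun A : WW F => A ![0, 1] ![0, 1]) h
    have h₁0 := congrFun h₁ 0
    have h₁1 := congrFun h₁ 1
    have h₂0 := congrFun h₂ 0
    have h₂1 := congrFun h₂ 1
    simp [ofCoords_apply] at h₁0 h₁1 h₂0 h₂1
    exact ⟨h₁0, h₁1, h₂1, h₂0⟩
  · rintro ⟨rfl, rfl, rfl, rfl⟩
    rfl

theorem smul_ofCoords (r a b c d : F) :
    r • ofCoords F a b c d = ofCoords F (r * a) (r * b) (r * c) (r * d) := by
  simp only [ofCoords, smul_add, smul_smul]

theorem ofCoords_add (a b c d a' b' c' d' : F) :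
    ofCoords F a b c d + ofCoords F a' b' c' d' =
      ofCoords F (a + a') (b + b') (c + c') (d + d') := by
  simp only [ofCoords, add_smul]
  abel

theorem wmul_ofCoords (a b c d a' b' c' d' : F) :
    wmul F (ofCoords F a b c d) (ofCoords F a' b' c' d') =
      ofCoords F (-a * a' + 2 * b * c' - c * b') (-3 * a * b' + 3 * b * a')
        (a * c' + b * d' - 2 * c * a') (3 * a * d' - 3 * c * c') := by
  refine LinearMap.ext fun x => LinearMap.ext fun y => ?_
  ext i
  fin_cases i <;> simp [wmul, vone, ofCoords_apply] <;> ring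

theorem fixing_vone_apply (f : V2 F ≃ₗ[F] V2 F) (hf : f (vone F) = vone F) (x : V2 F) :
    f x = ![x 0 + f ![0, 1] 0 * x 1, f ![0, 1] 1 * x 1] := by
  have hx : x = x 0 • vone F + x 1 • ![0, 1] := by
    ext i
    fin_cases i <;> simp [vone]
  conv_lhs => rw [hx, map_add, map_smul, map_smul, hf]
  ext i
  fin_cases i <;> simp [vone, mul_comm]

theorem fixing_vone_ne_zero (f : V2 F ≃ₗ[F] V2 F) (hf : f (vone F) = vone F) :
    f ![0, 1] 1 ≠ 0 := by
  intro h
  have h' : f ![0, 1] = f ![f ![0, 1] 0, 0] := by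
    rw [fixing_vone_apply F f hf ![f ![0, 1] 0, 0]]
    ext i
    fin_cases i <;> simp [h]
  have := congrFun (f.injective h') 1
  simp at this

theorem PsiMap_ofCoords (f : V2 F ≃ₗ[F] V2 F) (hf : f (vone F) = vone F)
    {s t : F} (hs : f ![0, 1] 0 = s) (ht : f ![0, 1] 1 = t) (a b c d : F) :
    PsiMap F f (ofCoords F a b c d) =
      ofCoords F (a + s * b) (t * b) ((s ^ 2 * b + 2 * s * a + c) / t)
        ((s ^ 3 * b + 3 * s ^ 2 * a + 3 * s * c + d) / t ^ 2) := by
  have ht0 : t ≠ 0 := ht ▸ fixing_vone_ne_zero F f hf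
  have hf' := fixing_vone_apply F f hf
  rw [hs, ht] at hf'
  refine LinearMap.ext fun x => LinearMap.ext fun y => ?_
  obtain ⟨x, rfl⟩ := f.surjective x
  obtain ⟨y, rfl⟩ := f.surjective y
  simp only [PsiMap, LinearEquiv.arrowCongr_apply, LinearEquiv.symm_apply_apply]
  rw [hf' x, hf' y, hf', ofCoords_apply, ofCoords_apply]
  ext i
  fin_cases i <;> simp <;> field_simp <;> ring

theorem PsiMap_mem (f : V2 F ≃ₗ[F] V2 F) (hf : f (vone F) = vone F) {A : WW F}
    (hA : A ∈ S2span F) : PsiMap F f A ∈ S2span F := by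
  obtain ⟨a, b, c, d, rfl⟩ := (mem_S2span_iff F A).1 hA
  rw [PsiMap_ofCoords F f hf rfl rfl]
  exact ofCoords_mem F _ _ _ _

theorem map_PsiMap_S2span (f : V2 F ≃ₗ[F] V2 F) (hf : f (vone F) = vone F) :
    Submodule.map (PsiMap F f).toLinearMap (S2span F) = S2span F := by
  apply le_antisymm
  · rintro _ ⟨A, hA, rfl⟩
    exact PsiMap_mem F f hf hA
  · intro A hA
    have hf' : f.symm (vone F) = vone F := by rw [LinearEquiv.symm_apply_eq, hf]
    refine ⟨PsiMap F f.symm A, PsiMap_mem F f.symm hf' hA, ?_⟩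
    refine LinearMap.ext fun x => LinearMap.ext fun y => ?_
    simp [PsiMap, LinearEquiv.arrowCongr_apply]

/-- The linear automorphism of `F²` with `v₁ ↦ v₁` and `v₂ ↦ s v₁ + t v₂`. -/
def fixingEquiv (s t : F) (ht : t ≠ 0) : V2 F ≃ₗ[F] V2 F where
  toFun x := ![x 0 + s * x 1, t * x 1]
  invFun x := ![x 0 - s * (x 1 / t), x 1 / t]
  map_add' x y := by
    ext i
    fin_cases i <;> simp <;> ring
  map_smul' r x := by
    ext i
    fin_cases i <;> simp <;> ring
  left_inv x := by
    ext i
    fin_cases i <;> simp [ht]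
  right_inv x := by
    ext i
    fin_cases i <;> simp
    field_simp

theorem fixingEquiv_apply (s t : F) (ht : t ≠ 0) (x : V2 F) :
    fixingEquiv F s t ht x = ![x 0 + s * x 1, t * x 1] := rfl

theorem fixingEquiv_vone (s t : F) (ht : t ≠ 0) :
    fixingEquiv F s t ht (vone F) = vone F := by
  ext i
  fin_cases i <;> simp [fixingEquiv_apply, vone]

/-- An automorphism of `S₂` has the shape of some `Φ(f)` on the basis `e₁, e₂, e₃, e₄`. -/
theorem automorphism_coords (G : S2span F ≃ₗ[F] S2span F)
    (hG : ∀ a b c : S2span F, wmul F a.1 b.1 = c.1 → wmul F (G a).1 (G b).1 = (G c).1) :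
    ∃ s t : F, t ≠ 0 ∧
      (G ⟨_, ofCoords_mem F 1 0 0 0⟩).1 = ofCoords F 1 0 (2 * s / t) (3 * s ^ 2 / t ^ 2) ∧
      (G ⟨_, ofCoords_mem F 0 1 0 0⟩).1 = ofCoords F s t (s ^ 2 / t) (s ^ 3 / t ^ 2) ∧
      (G ⟨_, ofCoords_mem F 0 0 1 0⟩).1 = ofCoords F 0 0 (1 / t) (3 * s / t ^ 2) ∧
      (G ⟨_, ofCoords_mem F 0 0 0 1⟩).1 = ofCoords F 0 0 0 (1 / t ^ 2) := by
  set E₁ : S2span F := ⟨_, ofCoords_mem F 1 0 0 0⟩ with hE₁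
  set E₂ : S2span F := ⟨_, ofCoords_mem F 0 1 0 0⟩ with hE₂
  set E₃ : S2span F := ⟨_, ofCoords_mem F 0 0 1 0⟩ with hE₃
  set E₄ : S2span F := ⟨_, ofCoords_mem F 0 0 0 1⟩ with hE₄
  have key : ∀ (r : F) (A B C : S2span F), wmul F A.1 B.1 = r • C.1 →
      wmul F (G A).1 (G B).1 = r • (G C).1 := by
    intro r A B C h
    have := hG A B (r • C) (by simpa using h)
    simpa using this
  obtain ⟨a₁, b₁, c₁, d₁, h₁⟩ := (mem_S2span_iff F _).1 (G E₁).2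
  obtain ⟨a₂, b₂, c₂, d₂, h₂⟩ := (mem_S2span_iff F _).1 (G E₂).2
  obtain ⟨a₃, b₃, c₃, d₃, h₃⟩ := (mem_S2span_iff F _).1 (G E₃).2
  obtain ⟨a₄, b₄, c₄, d₄, h₄⟩ := (mem_S2span_iff F _).1 (G E₄).2
  -- `e₄` spans the left annihilator of `S₂`.
  have hann : ∀ B : S2span F, wmul F (G E₄).1 B.1 = 0 := by
    intro B
    obtain ⟨B, rfl⟩ := G.surjective B
    have : wmul F E₄.1 B.1 = (0 : F) • E₄.1 := by
      obtain ⟨a, b, c, d, h⟩ := (mem_S2span_iff F _).1 B.2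
      rw [h, hE₄, wmul_ofCoords, smul_ofCoords, ofCoords_inj]
      simp
    simpa using key 0 E₄ B E₄ this
  have hzero : (0 : WW F) = ofCoords F 0 0 0 0 := by simp [ofCoords]
  have hann₁ := hann E₁
  have hann₂ := hann E₂
  rw [h₄, hE₁, wmul_ofCoords, hzero, ofCoords_inj] at hann₁
  rw [h₄, hE₂, wmul_ofCoords, hzero, ofCoords_inj] at hann₂
  obtain rfl : a₄ = 0 := by simpa using hann₁.1
  obtain rfl : b₄ = 0 := by simpa using hann₁.2.1
  obtain rfl : c₄ = 0 := by simpa using hann₁.2.2.1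
  have hd₄ : d₄ ≠ 0 := by
    rintro rfl
    have hE : E₄ = 0 := by
      apply G.injective
      rw [map_zero]
      exact Subtype.ext (by rw [h₄, ← hzero]; rfl)
    have := congrArg Subtype.val hE
    rw [hE₄] at this
    simp only [ZeroMemClass.coe_zero] at this
    rw [hzero, ofCoords_inj] at this
    simp at this
  have m₁₄ := key 3 E₁ E₄ E₄ (by simp [hE₁, hE₄, wmul_ofCoords, smul_ofCoords])
  have m₃₄ := key 0 E₃ E₄ E₄ (by simp [hE₃, hE₄, wmul_ofCoords, ← hzero])
  have m₂₄ := key 1 E₂ E₄ E₃ (by simp [hE₂, hE₃, hE₄, wmul_ofCoords])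
  have m₃₃ := key (-3) E₃ E₃ E₄ (by simp [hE₃, hE₄, wmul_ofCoords, smul_ofCoords])
  have m₁₃ := key 1 E₁ E₃ E₃ (by simp [hE₁, hE₃, wmul_ofCoords])
  have m₁₁ := key (-1) E₁ E₁ E₁ (by simp [hE₁, wmul_ofCoords, smul_ofCoords])
  have m₁₂ := key (-3) E₁ E₂ E₂ (by simp [hE₁, hE₂, wmul_ofCoords, smul_ofCoords])
  rw [h₁, h₄, wmul_ofCoords, smul_ofCoords, ofCoords_inj] at m₁₄
  rw [h₃, h₄, wmul_ofCoords, smul_ofCoords, ofCoords_inj] at m₃₄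
  rw [h₂, h₄, h₃, wmul_ofCoords, smul_ofCoords, ofCoords_inj] at m₂₄
  rw [h₃, h₄, wmul_ofCoords, smul_ofCoords, ofCoords_inj] at m₃₃
  rw [h₁, h₃, wmul_ofCoords, smul_ofCoords, ofCoords_inj] at m₁₃
  rw [h₁, wmul_ofCoords, smul_ofCoords, ofCoords_inj] at m₁₁
  rw [h₁, h₂, wmul_ofCoords, smul_ofCoords, ofCoords_inj] at m₁₂
  obtain rfl : b₁ = 0 := by simpa [hd₄] using m₁₄.2.2.1
  obtain rfl : a₁ = 1 := by simpa [hd₄] using m₁₄.2.2.2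
  obtain rfl : a₃ = 0 := by simpa [hd₄] using m₃₄.2.2.2
  obtain rfl : b₃ = 0 := by simpa [hd₄] using m₃₄.2.2.1
  obtain rfl : d₄ = c₃ ^ 2 := by linear_combination (1 / 3 : F) * m₃₃.2.2.2
  have hc₃ : c₃ ≠ 0 := fun h => hd₄ (by simp [h])
  obtain rfl : d₃ = 3 / 2 * c₁ * c₃ := by linear_combination (1 / 2 : F) * m₁₃.2.2.2
  obtain rfl : d₁ = 3 / 4 * c₁ ^ 2 := by linear_combination (1 / 4 : F) * m₁₁.2.2.2
  obtain rfl : b₂ = 1 / c₃ := by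
    field_simp
    apply mul_right_cancel₀ hc₃
    linear_combination m₂₄.2.2.1
  obtain rfl : a₂ = c₁ / (2 * c₃) := by
    have := m₁₂.1
    field_simp at this ⊢
    linear_combination this
  obtain rfl : c₂ = c₁ ^ 2 / (4 * c₃) := by
    have := m₁₂.2.2.1
    field_simp at this ⊢
    linear_combination this
  obtain rfl : d₂ = c₁ ^ 3 / (8 * c₃) := by
    have := m₁₂.2.2.2
    field_simp at this ⊢
    linear_combination this
  refine ⟨c₁ / (2 * c₃), 1 / c₃, by simpa using hc₃, ?_, ?_, ?_, ?_⟩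
  · rw [h₁, ofCoords_inj]
    refine ⟨?_, ?_, ?_, ?_⟩ <;> field_simp <;> ring
  · rw [h₂, ofCoords_inj]
    refine ⟨?_, ?_, ?_, ?_⟩ <;> field_simp <;> ring
  · rw [h₃, ofCoords_inj]
    refine ⟨?_, ?_, ?_, ?_⟩ <;> field_simp
  · rw [h₄, ofCoords_inj]
    refine ⟨?_, ?_, ?_, ?_⟩ <;> field_simp

/-- Φ(f) maps S₂ onto itself, and the induced homomorphism GL(V₂,v₁) → Aut(S₂)
is bijective. -/
theorem statement12 :
    (∀ f : V2 F ≃ₗ[F] V2 F, f (vone F) = vone F →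
        Submodule.map (PsiMap F f).toLinearMap (S2span F) = S2span F) ∧
    (∀ g : S2span F ≃ₗ[F] S2span F,
        (∀ a b c : S2span F, wmul F a.1 b.1 = c.1 →
            wmul F (g a).1 (g b).1 = (g c).1) →
        ∃! f : V2 F ≃ₗ[F] V2 F, f (vone F) = vone F ∧
          ∀ A : S2span F, ((g A : S2span F) : WW F) = PsiMap F f (A : WW F)) := by
  refine ⟨map_PsiMap_S2span F, fun g hg => ?_⟩
  obtain ⟨s, t, ht, h₁, h₂, h₃, h₄⟩ := automorphism_coords F g hg
  have h_lift : ∀ (A : S2span F) (a b c d : F), A.1 = ofCoords F a b c d →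
      A = a • (⟨_, ofCoords_mem F 1 0 0 0⟩ : S2span F) + b • ⟨_, ofCoords_mem F 0 1 0 0⟩ +
        c • ⟨_, ofCoords_mem F 0 0 1 0⟩ + d • ⟨_, ofCoords_mem F 0 0 0 1⟩ := by
    intro A a b c d hA
    apply Subtype.ext
    simp [hA, ofCoords]
  refine ⟨fixingEquiv F s t ht, ⟨fixingEquiv_vone F s t ht, fun A => ?_⟩, ?_⟩
  · obtain ⟨a, b, c, d, hA⟩ := (mem_S2span_iff F A.1).1 A.2
    rw [hA, PsiMap_ofCoords F _ (fixingEquiv_vone F s t ht) (s := s) (t := t)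
      (by simp [fixingEquiv_apply]) (by simp [fixingEquiv_apply]), h_lift A a b c d hA]
    simp only [map_add, map_smul, Submodule.coe_add, Submodule.coe_smul, h₁, h₂, h₃, h₄,
      smul_ofCoords, ofCoords_add]
    rw [ofCoords_inj]
    refine ⟨?_, ?_, ?_, ?_⟩ <;> ring
  · rintro f ⟨hf, hfg⟩
    have h := hfg ⟨_, ofCoords_mem F 0 1 0 0⟩
    rw [h₂, PsiMap_ofCoords F f hf rfl rfl, ofCoords_inj] at h
    apply LinearEquiv.ext
    intro x
    have hs : f ![0, 1] 0 = s := by simpa using h.1.symm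
    have ht' : f ![0, 1] 1 = t := by simpa using h.2.1.symm
    rw [fixing_vone_apply F f hf, fixingEquiv_apply, hs, ht']

end
end
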